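/- arXiv:2303.16348 — 2 statements merged into one kernel-verified Lean document; each statement's English description precedes it below -/
import Mathlib

section
/- Let r ≥ 1 and k₁,…,k_r ≥ 2 be integers with K = k₁⋯k_r, and suppose there exists j ∈ [r] such that both k_j and K/k_j are even. Then for a function f : G → ℝ one has E_{k₁,…,k_r}(f) = 0 if and only if f is identically zero. -/
open scoped BigOperators

attribute [local instance] Classical.propDecidable

noncomputable section

/-- The generalized energy
`E_{k₁,…,k_r}(f) = Σ_{x₁∈G^{k₁}} ⋯ Σ_{x_r∈G^{k_r}} ∏_{ω∈B} f(x₁^{(ω₁)} + ⋯ + x_r^{(ω_r)})`,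
where `B = [k₁]×…×[k_r]`. -/
def genEnergy (G : Type*) [AddCommGroup G] [Fintype G] {r : ℕ} (k : Fin r → ℕ)
    (f : G → ℝ) : ℝ :=
  ∑ x : (j : Fin r) → Fin (k j) → G, ∏ ω : (j : Fin r) → Fin (k j), f (∑ j, x j (ω j))

/-- The multi-scalar product
`⟨f^ω⟩ = Σ_{x₁∈G^{k₁}} ⋯ Σ_{x_r∈G^{k_r}} ∏_{ω∈B} f^ω(x₁^{(ω₁)} + ⋯ + x_r^{(ω_r)})`. -/
def genProd (G : Type*) [AddCommGroup G] [Fintype G] {r : ℕ} (k : Fin r → ℕ)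
    (F : ((j : Fin r) → Fin (k j)) → G → ℝ) : ℝ :=
  ∑ x : (j : Fin r) → Fin (k j) → G, ∏ ω : (j : Fin r) → Fin (k j), F ω (∑ j, x j (ω j))
/-- Separating the `j`-th block of variables writes the energy as a sum of `k j`-th powers. -/
lemma genEnergy_eq_sum_pow {G : Type*} [AddCommGroup G] [Fintype G] {r : ℕ} (k : Fin r → ℕ)
    (j : Fin r) (f : G → ℝ) :
    genEnergy G k f = ∑ y : (i : {i // i ≠ j}) → Fin (k i) → G,
      (∑ t : G, ∏ ω : (i : {i // i ≠ j}) → Fin (k i), f (t + ∑ i, y i (ω i))) ^ k j := by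
  have hsum (z : Fin r → G) : ∑ i, z i = z j + ∑ i : {i // i ≠ j}, z i := by
    rw [← Finset.add_sum_erase _ _ (Finset.mem_univ j)]
    congr 1
    exact Finset.sum_subtype _ (by simp) _
  unfold genEnergy
  rw [Fintype.sum_equiv (Equiv.piSplitAt j fun i => Fin (k i) → G) _
    (fun p => ∏ q : Fin (k j) × ((i : {i // i ≠ j}) → Fin (k i)),
      f (p.1 q.1 + ∑ i, p.2 i (q.2 i))), Fintype.sum_prod_type_right]
  · refine Finset.sum_congr rfl fun y _ => ?_
    simp only [Fintype.prod_prod_type, Fintype.sum_pow]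
  · intro x
    refine Fintype.prod_equiv (Equiv.piSplitAt j fun i => Fin (k i)) _ _ fun ω => ?_
    rw [hsum]
    rfl

theorem statement13 {G : Type*} [AddCommGroup G] [Fintype G]
    (r : ℕ) (hr : 1 ≤ r) (k : Fin r → ℕ) (hk : ∀ j, 2 ≤ k j)
    (hj : ∃ j : Fin r, Even (k j) ∧ Even (∏ i ∈ Finset.univ.erase j, k i))
    (f : G → ℝ) :
    genEnergy G k f = 0 ↔ ∀ x, f x = 0 := by
  constructor
  · intro h x
    obtain ⟨j, hj, hK⟩ := hj
    rw [genEnergy_eq_sum_pow k j,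
      Finset.sum_eq_zero_iff_of_nonneg fun _ _ => hj.pow_nonneg _] at h
    have h0 := pow_eq_zero_iff (by have := hk j; omega) |>.1 (h 0 (Finset.mem_univ _))
    have hcard : Even (Fintype.card ((i : {i // i ≠ j}) → Fin (k i))) := by
      rw [Finset.prod_subtype (p := fun i => i ≠ j) (F := inferInstance) _ (by simp)] at hK
      simpa [Fintype.card_pi] using hK
    have hcard0 : Fintype.card ((i : {i // i ≠ j}) → Fin (k i)) ≠ 0 := by
      have (i : Fin r) : NeZero (k i) := ⟨by have := hk i; omega⟩
      exact Fintype.card_ne_zero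
    simp only [Pi.zero_apply, Finset.sum_const_zero, add_zero, Finset.prod_const,
      Finset.card_univ] at h0
    rw [Finset.sum_eq_zero_iff_of_nonneg fun _ _ => hcard.pow_nonneg _] at h0
    exact (pow_eq_zero_iff hcard0).1 (h0 x (Finset.mem_univ _))
  · intro h
    have (j : Fin r) : NeZero (k j) := ⟨by have := hk j; omega⟩
    simp [genEnergy, h, Finset.prod_eq_zero_iff, NeZero.ne]
end
end

section
/- Let r ≥ 2 be an integer, k₁,…,k_r ≥ 2 be even integers, and K = k₁⋯k_r. Then for all functions f, g : G → ℝ one has the triangle inequality E_{k₁,…,k_r}(f+g)^{1/K} ≤ E_{k₁,…,k_r}(f)^{1/K} + E_{k₁,…,k_r}(g)^{1/K}; in particular f ↦ E_{k₁,…,k_r}(f)^{1/K} is a norm on the space of real functions on G. -/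
open scoped BigOperators

attribute [local instance] Classical.propDecidable

noncomputable section

/-- **Hölder's inequality** for a finite family of finite sums with equal exponents. -/
theorem sum_prod_pow_card_le {α ι : Type*} [Fintype α] [Nonempty α] [Fintype ι]
    (h : α → ι → ℝ) (hh : ∀ a i, 0 ≤ h a i) :
    (∑ i, ∏ a, h a i) ^ Fintype.card α ≤ ∏ a, ∑ i, h a i ^ Fintype.card α := by
  set n := Fintype.card α with hn
  have hn0 : n ≠ 0 := Fintype.card_ne_zero
  have hnR : (n : ℝ) ≠ 0 := Nat.cast_ne_zero.2 hn0
  have hS : ∀ a, 0 ≤ ∑ i, h a i ^ n := fun a => Finset.sum_nonneg fun i _ => pow_nonneg (hh a i) n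
  by_cases hz : ∃ a, ∑ i, h a i ^ n = 0
  · obtain ⟨a, ha⟩ := hz
    have hzero : ∀ i, h a i = 0 := fun i =>
      eq_zero_of_pow_eq_zero
        ((Finset.sum_eq_zero_iff_of_nonneg fun i _ => pow_nonneg (hh a i) n).1 ha i
          (Finset.mem_univ i))
    have hsum : ∑ i, ∏ a, h a i = 0 :=
      Finset.sum_eq_zero fun i _ => Finset.prod_eq_zero (Finset.mem_univ a) (hzero i)
    rw [hsum, zero_pow hn0]
    exact Finset.prod_nonneg fun a _ => hS a
  push Not at hz
  set L : α → ℝ := fun a => (∑ i, h a i ^ n) ^ (n : ℝ)⁻¹ with hL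
  have hLpow : ∀ a, L a ^ n = ∑ i, h a i ^ n := fun a => Real.rpow_inv_natCast_pow (hS a) hn0
  have hLpos : ∀ a, 0 < L a := fun a => Real.rpow_pos_of_pos ((hS a).lt_of_ne' (hz a)) _
  have amgm : ∀ i, ∏ a, h a i / L a ≤ ∑ a, (n : ℝ)⁻¹ * (h a i / L a) ^ n := by
    intro i
    have hnn : ∀ a, 0 ≤ h a i / L a := fun a => div_nonneg (hh a i) (hLpos a).le
    have := Real.geom_mean_le_arith_mean_weighted Finset.univ (fun _ : α => (n : ℝ)⁻¹)
      (fun a => (h a i / L a) ^ n) (fun _ _ => by positivity)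
      (by simp [← hn, hnR]) (fun a _ => pow_nonneg (hnn a) n)
    simpa only [Real.pow_rpow_inv_natCast (hnn _) hn0] using this
  have hone : ∑ i, ∏ a, h a i / L a ≤ 1 := by
    refine (Finset.sum_le_sum fun i _ => amgm i).trans_eq ?_
    rw [Finset.sum_comm]
    have : ∀ a, ∑ i, (n : ℝ)⁻¹ * (h a i / L a) ^ n = (n : ℝ)⁻¹ := by
      intro a
      rw [← Finset.mul_sum]
      simp only [div_pow]
      rw [← Finset.sum_div, hLpow, div_self (hz a), mul_one]
    simp [this, ← hn, hnR]
  have hle : ∑ i, ∏ a, h a i ≤ ∏ a, L a := by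
    simp only [Finset.prod_div_distrib] at hone
    rwa [← Finset.sum_div, div_le_one (Finset.prod_pos fun a _ => hLpos a)] at hone
  calc (∑ i, ∏ a, h a i) ^ n ≤ (∏ a, L a) ^ n :=
        pow_le_pow_left₀ (Finset.sum_nonneg fun i _ => Finset.prod_nonneg fun a _ => hh a i) hle n
    _ = ∏ a, ∑ i, h a i ^ n := by simp only [← Finset.prod_pow, hLpow]

section genProd

variable {G : Type*} [AddCommGroup G] [Fintype G] {r : ℕ} {k : Fin r → ℕ}

theorem genProd_const (f : G → ℝ) : genProd G k (fun _ => f) = genEnergy G k f := rfl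

/-- Summing over the `j`-th block of variables factors the product over the `j`-th index. -/
theorem genProd_eq_sum_prod (j : Fin r) (F : ((j : Fin r) → Fin (k j)) → G → ℝ) :
    genProd G k F = ∑ y : (i : {i // i ≠ j}) → Fin (k i) → G, ∏ a : Fin (k j),
      ∑ t : G, ∏ ω : (i : {i // i ≠ j}) → Fin (k i),
        F ((Equiv.piSplitAt j fun i => Fin (k i)).symm (a, ω)) (t + ∑ i, y i (ω i)) := by
  unfold genProd
  rw [← (Equiv.piSplitAt j fun i => Fin (k i) → G).symm.sum_comp, Fintype.sum_prod_type_right]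
  refine Finset.sum_congr rfl fun y _ => ?_
  rw [Fintype.prod_sum]
  refine Finset.sum_congr rfl fun u _ => ?_
  rw [← (Equiv.piSplitAt j fun i => Fin (k i)).symm.prod_comp, Fintype.prod_prod_type]
  refine Finset.prod_congr rfl fun a _ => Finset.prod_congr rfl fun ω _ => ?_
  congr 1
  rw [Fintype.sum_eq_add_sum_subtype_ne _ j]
  congr 1
  · simp [Equiv.piSplitAt]
  · refine Finset.sum_congr rfl fun i _ => ?_
    simp [Equiv.piSplitAt, i.2]

theorem update_piSplitAt_symm (j : Fin r) (a b : Fin (k j)) (ω : (i : {i // i ≠ j}) → Fin (k i)) :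
    Function.update ((Equiv.piSplitAt j fun i => Fin (k i)).symm (b, ω)) j a =
      (Equiv.piSplitAt j fun i => Fin (k i)).symm (a, ω) := by
  funext i
  by_cases h : i = j
  · subst h; simp [Equiv.piSplitAt]
  · simp [Equiv.piSplitAt, h]

/-- Freezing the `j`-th index at `a` turns the product into a sum of `k j`-th powers. -/
theorem genProd_update_eq_sum_pow (j : Fin r) (a : Fin (k j))
    (F : ((j : Fin r) → Fin (k j)) → G → ℝ) :
    genProd G k (fun ω => F (Function.update ω j a)) =
      ∑ y : (i : {i // i ≠ j}) → Fin (k i) → G,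
        (∑ t : G, ∏ ω : (i : {i // i ≠ j}) → Fin (k i),
          F ((Equiv.piSplitAt j fun i => Fin (k i)).symm (a, ω)) (t + ∑ i, y i (ω i))) ^ k j := by
  rw [genProd_eq_sum_prod j]
  simp only [update_piSplitAt_symm, Finset.prod_const, Finset.card_univ, Fintype.card_fin]

theorem genProd_update_nonneg {j : Fin r} (hj : Even (k j)) (a : Fin (k j))
    (F : ((j : Fin r) → Fin (k j)) → G → ℝ) :
    0 ≤ genProd G k (fun ω => F (Function.update ω j a)) := by
  rw [genProd_update_eq_sum_pow]
  exact Finset.sum_nonneg fun y _ => hj.pow_nonneg _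

theorem abs_genProd_pow_le {j : Fin r} (h0 : k j ≠ 0) (hj : Even (k j))
    (F : ((j : Fin r) → Fin (k j)) → G → ℝ) :
    |genProd G k F| ^ k j ≤ ∏ a, |genProd G k (fun ω => F (Function.update ω j a))| := by
  have : Nonempty (Fin (k j)) := ⟨⟨0, Nat.pos_of_ne_zero h0⟩⟩
  simp only [abs_of_nonneg (genProd_update_nonneg hj _ F)]
  simp only [genProd_update_eq_sum_pow]
  rw [genProd_eq_sum_prod j]
  refine (pow_le_pow_left₀ (abs_nonneg _) (Finset.abs_sum_le_sum_abs _ _) _).trans ?_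
  simp only [Finset.abs_prod]
  have := sum_prod_pow_card_le
    (fun (a : Fin (k j)) (y : (i : {i // i ≠ j}) → Fin (k i) → G) =>
      |∑ t : G, ∏ ω : (i : {i // i ≠ j}) → Fin (k i),
        F ((Equiv.piSplitAt j fun i => Fin (k i)).symm (a, ω)) (t + ∑ i, y i (ω i))|)
    (fun _ _ => abs_nonneg _)
  simpa only [Fintype.card_fin, hj.pow_abs] using this

theorem prod_prod_update (j : Fin r) (g : ((j : Fin r) → Fin (k j)) → ℝ) :
    ∏ τ, ∏ a, g (Function.update τ j a) = (∏ τ, g τ) ^ k j := by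
  have hsymm : ∏ p : ((i : Fin r) → Fin (k i)) × Fin (k j), g (Function.update p.1 j p.2) =
      ∏ p : ((i : Fin r) → Fin (k i)) × Fin (k j), g p.1 := by
    have hinv : Function.Involutive
        (fun p : ((i : Fin r) → Fin (k i)) × Fin (k j) => (Function.update p.1 j p.2, p.1 j)) := by
      intro p
      simp
    exact Equiv.prod_comp (hinv.toPerm _)
      fun p : ((i : Fin r) → Fin (k i)) × Fin (k j) => g p.1
  rw [Fintype.prod_prod_type, Fintype.prod_prod_type] at hsymm
  simpa [Finset.prod_pow] using hsymm

theorem abs_genProd_pow_card_le_piecewise (h0 : ∀ j, k j ≠ 0) (hke : ∀ j, Even (k j))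
    (F : ((j : Fin r) → Fin (k j)) → G → ℝ) (S : Finset (Fin r)) :
    |genProd G k F| ^ (∏ j, k j) ≤
      ∏ τ : (j : Fin r) → Fin (k j), |genProd G k (fun ω => F (S.piecewise τ ω))| := by
  induction S using Finset.induction_on with
  | empty => simp
  | insert j S hjS ih =>
    refine ih.trans ?_
    refine le_of_pow_le_pow_left₀ (h0 j) (Finset.prod_nonneg fun _ _ => abs_nonneg _) ?_
    rw [← Finset.prod_pow, ← prod_prod_update j
      fun τ => |genProd G k fun ω => F ((insert j S).piecewise τ ω)|]
    refine Finset.prod_le_prod (fun _ _ => pow_nonneg (abs_nonneg _) _) fun τ _ => ?_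
    refine (abs_genProd_pow_le (h0 j) (hke j) _).trans_eq ?_
    refine Finset.prod_congr rfl fun a _ => ?_
    have hpw : ∀ ω : (j : Fin r) → Fin (k j), S.piecewise τ (Function.update ω j a) =
        (insert j S).piecewise (Function.update τ j a) ω := by
      intro ω
      funext i
      by_cases hij : i = j
      · subst hij; simp [hjS]
      · by_cases hiS : i ∈ S <;> simp [Finset.piecewise, hij, hiS]
    simp only [hpw]

/-- The **Gowers–Cauchy–Schwarz inequality** for generalized energies. -/
theorem abs_genProd_pow_card_le (h0 : ∀ j, k j ≠ 0) (hke : ∀ j, Even (k j))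
    (F : ((j : Fin r) → Fin (k j)) → G → ℝ) :
    |genProd G k F| ^ (∏ j, k j) ≤ ∏ τ, |genEnergy G k (F τ)| := by
  simpa [genProd_const] using abs_genProd_pow_card_le_piecewise h0 hke F Finset.univ

theorem genEnergy_nonneg {j : Fin r} (h0 : k j ≠ 0) (hj : Even (k j)) (f : G → ℝ) :
    0 ≤ genEnergy G k f :=
  genProd_update_nonneg hj ⟨0, Nat.pos_of_ne_zero h0⟩ fun _ => f

theorem genEnergy_smul (c : ℝ) (f : G → ℝ) :
    genEnergy G k (c • f) = c ^ (∏ j, k j) * genEnergy G k f := by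
  simp [genEnergy, Finset.mul_sum, Finset.prod_mul_distrib]

theorem abs_genProd_le (h0 : ∀ j, k j ≠ 0) (hke : ∀ j, Even (k j))
    (F : ((j : Fin r) → Fin (k j)) → G → ℝ) :
    |genProd G k F| ≤ ∏ τ, |genEnergy G k (F τ)| ^ (((∏ j, k j : ℕ) : ℝ)⁻¹) := by
  have hK : ∏ j, k j ≠ 0 := Finset.prod_ne_zero_iff.2 fun j _ => h0 j
  refine le_of_pow_le_pow_left₀ hK
    (Finset.prod_nonneg fun _ _ => Real.rpow_nonneg (abs_nonneg _) _) ?_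
  rw [← Finset.prod_pow]
  simpa only [Real.rpow_inv_natCast_pow (abs_nonneg _) hK] using abs_genProd_pow_card_le h0 hke F

theorem genEnergy_add_le (h0 : ∀ j, k j ≠ 0) (hke : ∀ j, Even (k j)) (f g : G → ℝ) :
    genEnergy G k (f + g) ≤ (|genEnergy G k f| ^ (((∏ j, k j : ℕ) : ℝ)⁻¹) +
      |genEnergy G k g| ^ (((∏ j, k j : ℕ) : ℝ)⁻¹)) ^ (∏ j, k j) := by
  have hexp : genEnergy G k (f + g) = ∑ T : Finset ((j : Fin r) → Fin (k j)),
      genProd G k (fun ω => if ω ∈ T then f else g) := by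
    simp only [genEnergy, genProd, Pi.add_apply, Fintype.prod_add]
    rw [Finset.sum_comm]
    refine Finset.sum_congr rfl fun T _ => Finset.sum_congr rfl fun x _ => ?_
    rw [← Finset.prod_mul_prod_compl T]
    congr 1
    · exact Finset.prod_congr rfl fun ω hω => by rw [if_pos hω]
    · exact Finset.prod_congr rfl fun ω hω => by rw [if_neg (Finset.mem_compl.1 hω)]
  have hcard : ∏ j, k j = Fintype.card ((j : Fin r) → Fin (k j)) := by simp
  rw [hexp]
  nth_rewrite 3 [hcard]
  rw [← Finset.card_univ, ← Finset.prod_const, Fintype.prod_add]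
  refine Finset.sum_le_sum fun T _ => ?_
  refine (le_abs_self _).trans ((abs_genProd_le h0 hke _).trans_eq ?_)
  rw [← Finset.prod_mul_prod_compl T]
  congr 1
  · exact Finset.prod_congr rfl fun ω hω => by rw [if_pos hω]
  · exact Finset.prod_congr rfl fun ω hω => by rw [if_neg (Finset.mem_compl.1 hω)]

theorem genEnergy_single_pos (hr : 0 < r) (c : G) : 0 < genEnergy G k (Pi.single c 1) := by
  refine Finset.sum_pos' (fun x _ => Finset.prod_nonneg fun ω _ => ?_)
    ⟨fun j _ => if j = ⟨0, hr⟩ then c else 0, Finset.mem_univ _, ?_⟩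
  · exact (Pi.single_nonneg.2 zero_le_one : (0 : G → ℝ) ≤ Pi.single c 1) _
  · simp

/-- A function of zero energy vanishes: isolate the value `f c` by testing against indicators. -/
theorem eq_zero_of_genEnergy_eq_zero (hr : 2 ≤ r) (hk : ∀ j, 2 ≤ k j) (hke : ∀ j, Even (k j))
    {f : G → ℝ} (hf : genEnergy G k f = 0) : f = 0 := by
  have h0 : ∀ j, k j ≠ 0 := fun j => by have := hk j; lia
  have hK : ∏ j, k j ≠ 0 := Finset.prod_ne_zero_iff.2 fun j _ => h0 j
  funext c
  let δ : G → ℝ := Pi.single c 1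
  let p : Fin r := ⟨0, by lia⟩
  let q : Fin r := ⟨1, by lia⟩
  have hpq : p ≠ q := by simp [p, q]
  let ω₀ : (j : Fin r) → Fin (k j) := fun j => ⟨0, by have := hk j; lia⟩
  let F : ((j : Fin r) → Fin (k j)) → G → ℝ := fun ω => if ω = ω₀ then f else δ
  let u : Fin (k p) := ⟨1, hk p⟩
  let v : Fin (k q) := ⟨1, hk q⟩
  have hu : u ≠ ω₀ p := by simp [u, ω₀]
  have hv : v ≠ ω₀ q := by simp [v, ω₀]
  let ω₁ := Function.update ω₀ p u
  let ω₂ := Function.update ω₀ q v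
  let ω₃ := Function.update ω₁ q v
  have h1 : ω₁ ≠ ω₀ := fun h => hu (by simpa [ω₁] using congrFun h p)
  have h2 : ω₂ ≠ ω₀ := fun h => hv (by simpa [ω₂] using congrFun h q)
  have h3 : ω₃ ≠ ω₀ := fun h => hv (by simpa [ω₃] using congrFun h q)
  have hsum : ∀ x : (j : Fin r) → Fin (k j) → G,
      ∑ j, x j (ω₀ j) + ∑ j, x j (ω₃ j) = ∑ j, x j (ω₁ j) + ∑ j, x j (ω₂ j) := by
    intro x
    rw [← Finset.sum_add_distrib, ← Finset.sum_add_distrib]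
    refine Finset.sum_congr rfl fun j _ => ?_
    by_cases hq : j = q
    · subst hq
      simp [ω₁, ω₂, ω₃, hpq.symm]
    · simp [ω₁, ω₂, ω₃, hq, add_comm]
  have hF : genProd G k F = f c * genEnergy G k δ := by
    unfold genProd genEnergy
    rw [Finset.mul_sum]
    refine Finset.sum_congr rfl fun x _ => ?_
    rw [← Finset.mul_prod_erase _ _ (Finset.mem_univ ω₀),
      ← Finset.mul_prod_erase _ _ (Finset.mem_univ ω₀)]
    have hrest : ∏ ω ∈ Finset.univ.erase ω₀, F ω (∑ j, x j (ω j)) =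
        ∏ ω ∈ Finset.univ.erase ω₀, δ (∑ j, x j (ω j)) :=
      Finset.prod_congr rfl fun ω hω => by simp only [F, if_neg (Finset.ne_of_mem_erase hω)]
    rw [hrest]
    by_cases hall : ∀ ω, ω ≠ ω₀ → ∑ j, x j (ω j) = c
    · have hc : ∑ j, x j (ω₀ j) = c := by
        have := hsum x
        rw [hall _ h1, hall _ h2, hall _ h3] at this
        exact add_right_cancel this
      simp [hc, F, δ]
    · push Not at hall
      obtain ⟨ω, hω, hne⟩ := hall
      have : ∏ ω ∈ Finset.univ.erase ω₀, δ (∑ j, x j (ω j)) = 0 :=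
        Finset.prod_eq_zero (Finset.mem_erase.2 ⟨hω, Finset.mem_univ ω⟩)
          (Pi.single_eq_of_ne hne 1)
      simp [this]
  have hle := abs_genProd_pow_card_le h0 hke F
  rw [Finset.prod_eq_zero (Finset.mem_univ ω₀) (by simp [F, hf])] at hle
  have hzero : genProd G k F = 0 :=
    abs_eq_zero.1 (eq_zero_of_pow_eq_zero (hle.antisymm (pow_nonneg (abs_nonneg _) _)))
  rw [hF] at hzero
  exact (mul_eq_zero.1 hzero).resolve_right (genEnergy_single_pos (by lia) c).ne'

end genProd

theorem statement15 {G : Type*} [AddCommGroup G] [Fintype G]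
    (r : ℕ) (hr : 2 ≤ r) (k : Fin r → ℕ) (hk : ∀ j, 2 ≤ k j) (hke : ∀ j, Even (k j)) :
    (∀ f g : G → ℝ,
      genEnergy G k (f + g) ^ (((∏ j, k j : ℕ) : ℝ)⁻¹) ≤
        genEnergy G k f ^ (((∏ j, k j : ℕ) : ℝ)⁻¹) +
          genEnergy G k g ^ (((∏ j, k j : ℕ) : ℝ)⁻¹)) ∧
    -- in particular, `f ↦ E_{k₁,…,k_r}(f)^{1/K}` is a norm:
    (∀ f : G → ℝ, 0 ≤ genEnergy G k f ^ (((∏ j, k j : ℕ) : ℝ)⁻¹)) ∧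
    (∀ f : G → ℝ, genEnergy G k f ^ (((∏ j, k j : ℕ) : ℝ)⁻¹) = 0 ↔ f = 0) ∧
    (∀ (c : ℝ) (f : G → ℝ),
      genEnergy G k (c • f) ^ (((∏ j, k j : ℕ) : ℝ)⁻¹) =
        |c| * genEnergy G k f ^ (((∏ j, k j : ℕ) : ℝ)⁻¹)) := by
  have h0 : ∀ j, k j ≠ 0 := fun j => by have := hk j; lia
  have hK : ∏ j, k j ≠ 0 := Finset.prod_ne_zero_iff.2 fun j _ => h0 j
  have hKR : (((∏ j, k j : ℕ) : ℝ)⁻¹) ≠ 0 := inv_ne_zero (Nat.cast_ne_zero.2 hK)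
  let p : Fin r := ⟨0, by lia⟩
  have hE : ∀ f : G → ℝ, 0 ≤ genEnergy G k f := genEnergy_nonneg (h0 p) (hke p)
  have hKe : Even (∏ j, k j) :=
    even_iff_two_dvd.2 ((hke p).two_dvd.trans (Finset.dvd_prod_of_mem k (Finset.mem_univ p)))
  refine ⟨fun f g => ?_, fun f => Real.rpow_nonneg (hE f) _, fun f => ?_, fun c f => ?_⟩
  · have hle := genEnergy_add_le h0 hke f g
    rw [abs_of_nonneg (hE f), abs_of_nonneg (hE g)] at hle
    refine (Real.rpow_le_rpow (hE _) hle (by positivity)).trans_eq ?_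
    exact Real.pow_rpow_inv_natCast
      (add_nonneg (Real.rpow_nonneg (hE f) _) (Real.rpow_nonneg (hE g) _)) hK
  · rw [Real.rpow_eq_zero (hE f) hKR]
    refine ⟨eq_zero_of_genEnergy_eq_zero hr hk hke, ?_⟩
    rintro rfl
    have := genEnergy_smul (k := k) 0 (0 : G → ℝ)
    rwa [zero_smul, zero_pow hK, zero_mul] at this
  · rw [genEnergy_smul, ← hKe.pow_abs, Real.mul_rpow (pow_nonneg (abs_nonneg c) _) (hE f),
      Real.pow_rpow_inv_natCast (abs_nonneg c) hK]
end
end
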